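/- Let l = 5, let r be 1 or 2, and set a = [r]. Then p_{4,2}(1/a), p_{4,1}(1/a), and p_{8,3}(1/a) all lie in the subring S of L generated over ℤ/2 by [1] and [2]. -/

import Mathlib

open scoped Classical

/-- The theta series `[i]` for modulus `l`: `∑ x^(n²)` over integers `n ≡ i (mod l)`,
viewed in `ℤ/2[[x]]` (the coefficient of `x^k` is the mod-2 count of such `n` with `n² = k`). -/
noncomputable def theta (l i : ℤ) : PowerSeries (ZMod 2) :=
  PowerSeries.mk fun k => (({n : ℤ | n ≡ i [ZMOD l] ∧ n ^ 2 = (k : ℤ)}.ncard : ℕ) : ZMod 2)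

/-- The theta series viewed in the Laurent series field `L = ℤ/2((x))`. -/
noncomputable def thetaL (l i : ℤ) : LaurentSeries (ZMod 2) := (theta l i : LaurentSeries (ZMod 2))

/-- The projection `p_{q,j}` keeping only the coefficients in degrees `≡ j (mod q)`. -/
noncomputable def proj (q j : ℤ) (f : LaurentSeries (ZMod 2)) : LaurentSeries (ZMod 2) where
  coeff n := if n ≡ j [ZMOD q] then f.coeff n else 0
  isPWO_support' := f.isPWO_support'.mono (fun n hn => by
    simp only [Function.mem_support, ne_eq] at hn ⊢
    intro h; apply hn; split_ifs <;> simp [h])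

/-- `B(g)`: the set of integers `n` such that the coefficient of `x^n` in `1/g` is `1`. -/
noncomputable def Bset (g : PowerSeries (ZMod 2)) : Set ℤ :=
  {n : ℤ | ((g : LaurentSeries (ZMod 2))⁻¹).coeff n = 1}

/-- The subring `S` of `L` generated over `ℤ/2` by `[1], …, [m]`. -/
noncomputable def Sring (l : ℤ) (m : ℕ) : Subring (LaurentSeries (ZMod 2)) :=
  Subring.closure {x | ∃ i : ℕ, 1 ≤ i ∧ i ≤ m ∧ x = thetaL l i}

/-- The subring `S` of `ℤ/2[[x]]` generated over `ℤ/2` by `[1], …, [m]`. -/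
noncomputable def SringPS (l : ℤ) (m : ℕ) : Subring (PowerSeries (ZMod 2)) :=
  Subring.closure {x | ∃ i : ℕ, 1 ≤ i ∧ i ≤ m ∧ x = theta l i}

/-- The mod-2 generating series `∑_{i ∈ s} x^(f i)`. -/
noncomputable def genSeries {ι : Type*} (s : Set ι) (f : ι → ℕ) : PowerSeries (ZMod 2) :=
  PowerSeries.mk fun k => (({i | i ∈ s ∧ f i = k}.ncard : ℕ) : ZMod 2)

section GenSeries

variable {ι κ : Type*}

theorem genSeries_mul {s : Set ι} {t : Set κ} {f : ι → ℕ} {g : κ → ℕ}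
    (hf : ∀ k, {i | f i = k}.Finite) (hg : ∀ k, {i | g i = k}.Finite) :
    genSeries s f * genSeries t g = genSeries (s ×ˢ t) (fun p => f p.1 + g p.2) := by
  ext k
  simp only [genSeries, PowerSeries.coeff_mul, PowerSeries.coeff_mk]
  have hset : {i : ι × κ | i ∈ s ×ˢ t ∧ f i.1 + g i.2 = k} =
      ⋃ p ∈ (↑(Finset.HasAntidiagonal.antidiagonal k) : Set (ℕ × ℕ)),
        {i | i ∈ s ∧ f i = p.1} ×ˢ {j | j ∈ t ∧ g j = p.2} := by
    ext ⟨i, j⟩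
    simp only [Set.mem_ofPred_eq, Set.mem_prod, Set.mem_iUnion, Finset.mem_coe,
      Finset.HasAntidiagonal.mem_antidiagonal, exists_prop, Prod.exists]
    constructor
    · rintro ⟨⟨hi, hj⟩, h⟩
      exact ⟨f i, g j, h, ⟨hi, rfl⟩, hj, rfl⟩
    · rintro ⟨_, _, h, ⟨hi, rfl⟩, hj, rfl⟩
      exact ⟨⟨hi, hj⟩, h⟩
  rw [hset, Set.Finite.ncard_biUnion (Finset.finite_toSet _), finsum_mem_coe_finset, Nat.cast_sum]
  · simp [Set.ncard_prod]
  · exact fun p _ => ((hf p.1).subset fun i hi => hi.2).prod ((hg p.2).subset fun i hi => hi.2)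
  · intro p _ q _ hpq
    refine Set.disjoint_left.2 ?_
    rintro ⟨i, j⟩ ⟨⟨_, h1⟩, _, h2⟩ ⟨⟨_, h3⟩, _, h4⟩
    exact hpq (Prod.ext (h1.symm.trans h3) (h2.symm.trans h4))

theorem genSeries_sq (s : Set ι) (f : ι → ℕ) :
    genSeries s f ^ 2 = genSeries s (fun i => 2 * f i) := by
  have h : PowerSeries.expand 2 two_ne_zero (genSeries s f) = genSeries s f ^ 2 := by
    have := MvPowerSeries.map_frobenius_expand 2 two_ne_zero (f := genSeries s f)
    rw [ZMod.frobenius_zmod] at this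
    simpa [PowerSeries.expand] using this
  rw [← h]
  ext k
  rw [PowerSeries.coeff_expand]
  simp only [genSeries, PowerSeries.coeff_mk]
  split_ifs with hk
  · obtain ⟨m, rfl⟩ := hk
    simp
  · have : {i | i ∈ s ∧ 2 * f i = k} = ∅ := by
      ext i
      simp only [Set.mem_ofPred_eq, Set.mem_empty_iff_false, iff_false]
      rintro ⟨_, rfl⟩
      exact hk ⟨_, rfl⟩
    simp [this]

theorem genSeries_split (s : Set ι) {f : ι → ℕ} (hf : ∀ k, {i | f i = k}.Finite) (p : ι → Prop) :
    genSeries s f = genSeries {i | i ∈ s ∧ p i} f + genSeries {i | i ∈ s ∧ ¬ p i} f := by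
  ext k
  simp only [genSeries, map_add, PowerSeries.coeff_mk, Set.mem_ofPred_eq]
  rw [← Nat.cast_add, ← Set.ncard_union_eq
    (Set.disjoint_left.2 fun i h1 h2 => h2.1.2 h1.1.2)
    ((hf k).subset fun i hi => hi.2) ((hf k).subset fun i hi => hi.2)]
  congr 2
  ext i
  simp only [Set.mem_ofPred_eq, Set.mem_union]
  tauto

theorem genSeries_image {s : Set ι} {t : Set κ} {f : ι → ℕ} {g : κ → ℕ} (e : ι → κ)
    (he : e.Injective) (hst : e '' s = t) (hfg : ∀ i, g (e i) = f i) :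
    genSeries s f = genSeries t g := by
  subst hst
  ext k
  simp only [genSeries, PowerSeries.coeff_mk]
  rw [← Set.ncard_image_of_injective _ he]
  congr 2
  ext j
  simp only [Set.mem_image, Set.mem_ofPred_eq]
  constructor
  · rintro ⟨i, ⟨hi, rfl⟩, rfl⟩
    exact ⟨⟨i, hi, rfl⟩, hfg i⟩
  · rintro ⟨⟨i, hi, rfl⟩, h⟩
    exact ⟨i, ⟨hi, (hfg i).symm.trans h⟩, rfl⟩

end GenSeries

instance charP_powerSeries_two : CharP (PowerSeries (ZMod 2)) 2 :=
  charP_of_injective_ringHom PowerSeries.C_injective 2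

instance charP_laurentSeries_two : CharP (LaurentSeries (ZMod 2)) 2 :=
  charP_of_injective_ringHom HahnSeries.C_injective 2

theorem finite_mul_natAbs_sq {c : ℕ} (hc : c ≠ 0) (k : ℕ) :
    {n : ℤ | c * n.natAbs ^ 2 = k}.Finite := by
  refine (Set.finite_Icc (-(k : ℤ)) k).subset fun n hn => ?_
  have h1 : n.natAbs ≤ k := by
    rw [← (hn : c * n.natAbs ^ 2 = k)]
    exact (Nat.le_self_pow two_ne_zero _).trans (Nat.le_mul_of_pos_left _ (Nat.pos_of_ne_zero hc))
  exact ⟨by omega, by omega⟩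

theorem finite_natAbs_sq (k : ℕ) : {n : ℤ | n.natAbs ^ 2 = k}.Finite := by
  simpa using finite_mul_natAbs_sq one_ne_zero k

theorem finite_natAbs_sq_add (k : ℕ) :
    {p : ℤ × ℤ | p.1.natAbs ^ 2 + p.2.natAbs ^ 2 = k}.Finite := by
  refine ((Set.finite_Icc (-(k : ℤ)) k).prod (Set.finite_Icc (-(k : ℤ)) k)).subset
    fun p hp => ?_
  have h : p.1.natAbs ^ 2 + p.2.natAbs ^ 2 = k := hp
  have h1 := Nat.le_self_pow two_ne_zero p.1.natAbs
  have h2 := Nat.le_self_pow two_ne_zero p.2.natAbs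
  exact ⟨⟨by omega, by omega⟩, by omega, by omega⟩

theorem theta_eq_genSeries (l i : ℤ) :
    theta l i = genSeries {n : ℤ | n ≡ i [ZMOD l]} (fun n => n.natAbs ^ 2) := by
  ext k
  simp only [theta, genSeries, PowerSeries.coeff_mk]
  congr 3
  ext n
  have : n ^ 2 = (k : ℤ) ↔ n.natAbs ^ 2 = k := by
    rw [← Int.natAbs_sq]
    norm_cast
  simp [this]

theorem theta_pow_four (l i : ℤ) :
    theta l i ^ 4 = genSeries {n : ℤ | n ≡ i [ZMOD l]} (fun n => 4 * n.natAbs ^ 2) := by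
  rw [show 4 = 2 * 2 from rfl, pow_mul, theta_eq_genSeries, genSeries_sq, genSeries_sq]
  congr
  funext n
  ring

/-- The fourth power of a theta series is the even part of another theta series. -/
theorem theta_pow_four_eq_even {i j : ℤ} (h : j ≡ 2 * i [ZMOD 5] ∨ j ≡ -(2 * i) [ZMOD 5]) :
    theta 5 i ^ 4 =
      genSeries {n : ℤ | n ∈ {n : ℤ | n ≡ j [ZMOD 5]} ∧ Even n} (fun n => n.natAbs ^ 2) := by
  rw [theta_pow_four]
  rcases h with h | h
  · refine genSeries_image (fun n => 2 * n) (fun a b hab => by simpa using hab) ?_ ?_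
    · ext n
      simp only [Set.mem_image, Set.mem_ofPred_eq, Int.ModEq, Int.even_iff] at h ⊢
      constructor
      · rintro ⟨m, hm, rfl⟩
        omega
      · rintro ⟨h1, h2⟩
        exact ⟨n / 2, by omega, by omega⟩
    · intro n
      simp only [Int.natAbs_mul]
      norm_num
      ring
  · refine genSeries_image (fun n => -2 * n) (fun a b hab => by simpa using hab) ?_ ?_
    · ext n
      simp only [Set.mem_image, Set.mem_ofPred_eq, Int.ModEq, Int.even_iff] at h ⊢
      constructor
      · rintro ⟨m, hm, rfl⟩
        omega
      · rintro ⟨h1, h2⟩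
        exact ⟨-(n / 2), by omega, by omega⟩
    · intro n
      simp only [Int.natAbs_mul]
      norm_num
      ring

theorem theta_relation :
    theta 5 1 ^ 5 + theta 5 2 ^ 5 + theta 5 1 ^ 2 * theta 5 2 ^ 2 + theta 5 1 * theta 5 2 = 0 := by
  let N : ℤ × ℤ → ℕ := fun p => p.1.natAbs ^ 2 + p.2.natAbs ^ 2
  let T : Set (ℤ × ℤ) := {p | p.1 ≡ 1 [ZMOD 5] ∧ p.2 ≡ 2 [ZMOD 5]}
  have hN : ∀ k, {p | N p = k}.Finite := finite_natAbs_sq_add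
  have h1 : theta 5 1 ^ 5 = genSeries {p | p ∈ T ∧ Even p.2} N := by
    rw [pow_succ', theta_pow_four, theta_eq_genSeries,
      genSeries_mul finite_natAbs_sq (finite_mul_natAbs_sq four_ne_zero)]
    refine genSeries_image (fun p => (p.1, 2 * p.2)) ?_ ?_ ?_
    · rintro ⟨a, b⟩ ⟨c, d⟩ h
      simpa using h
    · ext ⟨p, q⟩
      simp only [T, Set.mem_image, Set.mem_ofPred_eq, Set.mem_prod, Prod.mk.injEq, Prod.exists,
        Int.ModEq, Int.even_iff]
      constructor
      · rintro ⟨a, b, h, rfl, rfl⟩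
        omega
      · intro h
        exact ⟨p, q / 2, by omega, by omega, by omega⟩
    · intro p
      simp only [N, Int.natAbs_mul]
      norm_num
      ring
  have h2 : theta 5 2 ^ 5 = genSeries {p | p ∈ T ∧ Even p.1} N := by
    rw [pow_succ', theta_pow_four, theta_eq_genSeries,
      genSeries_mul finite_natAbs_sq (finite_mul_natAbs_sq four_ne_zero)]
    refine genSeries_image (fun p => (-(2 * p.2), p.1)) ?_ ?_ ?_
    · rintro ⟨a, b⟩ ⟨c, d⟩ h
      simpa [and_comm] using h
    · ext ⟨p, q⟩
      simp only [T, Set.mem_image, Set.mem_ofPred_eq, Set.mem_prod, Prod.mk.injEq, Prod.exists,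
        Int.ModEq, Int.even_iff]
      constructor
      · rintro ⟨a, b, h, rfl, rfl⟩
        omega
      · intro h
        exact ⟨q, -(p / 2), by omega, by omega, by omega⟩
    · intro p
      simp only [N, Int.natAbs_neg, Int.natAbs_mul]
      norm_num
      ring
  have h3 : theta 5 1 * theta 5 2 = genSeries T N := by
    rw [theta_eq_genSeries, theta_eq_genSeries, genSeries_mul finite_natAbs_sq finite_natAbs_sq]
    rfl
  have h4 : theta 5 1 ^ 2 * theta 5 2 ^ 2 = genSeries {p | p ∈ T ∧ (Even p.1 ↔ Even p.2)} N := by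
    rw [← mul_pow, h3, genSeries_sq]
    refine genSeries_image (fun p => (p.2 - p.1, -(p.1 + p.2))) ?_ ?_ ?_
    · rintro ⟨a, b⟩ ⟨c, d⟩ h
      simp only [Prod.mk.injEq] at h ⊢
      omega
    · ext ⟨p, q⟩
      simp only [T, Set.mem_image, Set.mem_ofPred_eq, Prod.mk.injEq, Prod.exists,
        Int.ModEq, Int.even_iff]
      constructor
      · rintro ⟨a, b, h, rfl, rfl⟩
        omega
      · intro h
        exact ⟨-(p + q) / 2, (p - q) / 2, by omega, by omega, by omega⟩
    · intro p
      simp only [N]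
      zify
      simp only [sq_abs]
      ring
  rw [h1, h2, h3, h4, genSeries_split T hN fun p => Even p.1,
    genSeries_split {p | p ∈ T ∧ Even p.1} hN fun p => Even p.2,
    genSeries_split {p | p ∈ T ∧ ¬ Even p.1} hN fun p => Even p.2,
    genSeries_split {p | p ∈ T ∧ Even p.2} hN fun p => Even p.1,
    genSeries_split {p | p ∈ T ∧ (Even p.1 ↔ Even p.2)} hN fun p => Even p.1]
  have e1 : {p | p ∈ {p | p ∈ T ∧ Even p.2} ∧ Even p.1} =
      {p | p ∈ {p | p ∈ T ∧ Even p.1} ∧ Even p.2} := by ext; simp; tauto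
  have e2 : {p | p ∈ {p | p ∈ T ∧ Even p.2} ∧ ¬ Even p.1} =
      {p | p ∈ {p | p ∈ T ∧ ¬ Even p.1} ∧ Even p.2} := by ext; simp only [Set.mem_ofPred_eq]; tauto
  have e3 : {p | p ∈ {p | p ∈ T ∧ (Even p.1 ↔ Even p.2)} ∧ Even p.1} =
      {p | p ∈ {p | p ∈ T ∧ Even p.1} ∧ Even p.2} := by ext; simp only [Set.mem_ofPred_eq]; tauto
  have e4 : {p | p ∈ {p | p ∈ T ∧ (Even p.1 ↔ Even p.2)} ∧ ¬ Even p.1} =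
      {p | p ∈ {p | p ∈ T ∧ ¬ Even p.1} ∧ ¬ Even p.2} := by
    ext; simp only [Set.mem_ofPred_eq]; tauto
  rw [e1, e2, e3, e4]
  have : (2 : PowerSeries (ZMod 2)) = 0 := CharTwo.two_eq_zero
  grind

/-- The nonzero coefficients of `f` all lie in degrees `≡ j (mod q)`. -/
def InClass (q j : ℤ) (f : LaurentSeries (ZMod 2)) : Prop :=
  ∀ n, f.coeff n ≠ 0 → n ≡ j [ZMOD q]

theorem InClass.mul {q i j : ℤ} {f g : LaurentSeries (ZMod 2)} (hf : InClass q i f)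
    (hg : InClass q j g) : InClass q (i + j) (f * g) := by
  intro n hn
  rw [HahnSeries.coeff_mul] at hn
  obtain ⟨p, hp, hne⟩ := Finset.exists_ne_zero_of_sum_ne_zero hn
  rw [Finset.mem_antidiagonal] at hp
  rw [← hp.2.2]
  exact (hf _ (left_ne_zero_of_mul hne)).add (hg _ (right_ne_zero_of_mul hne))

theorem InClass.one (q : ℤ) : InClass q 0 1 := by
  intro n hn
  have : n = 0 := by
    by_contra h
    simp [HahnSeries.coeff_one, h] at hn
  rw [this]

theorem InClass.pow {q i : ℤ} {f : LaurentSeries (ZMod 2)} (hf : InClass q i f) (k : ℕ) :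
    InClass q (k * i) (f ^ k) := by
  induction k with
  | zero => simpa using InClass.one q
  | succ k ih =>
    rw [pow_succ, show ((k + 1 : ℕ) : ℤ) * i = k * i + i by push_cast; ring]
    exact ih.mul hf

/-- Squaring doubles both the modulus and the residue class, in characteristic two. -/
theorem InClass.sq {q i : ℤ} {f : LaurentSeries (ZMod 2)} (hf : InClass q i f) :
    InClass (2 * q) (2 * i) (f ^ 2) := by
  intro n hn
  by_contra hcon
  apply hn
  rw [_root_.sq, HahnSeries.coeff_mul]
  refine Finset.sum_involution (fun p _ => p.swap) ?_ ?_ ?_ ?_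
  · intro p _
    rw [Prod.fst_swap, Prod.snd_swap, mul_comm (f.coeff p.2)]
    exact CharTwo.add_self_eq_zero _
  · rintro ⟨a, b⟩ hp hne hab
    obtain rfl : b = a := congrArg Prod.fst hab
    rw [Finset.mem_antidiagonal] at hp
    apply hcon
    rw [← hp.2.2, ← two_mul]
    exact (hf _ (left_ne_zero_of_mul hne)).mul_left'
  · rintro ⟨a, b⟩ hp
    rw [Finset.mem_antidiagonal] at hp ⊢
    exact ⟨hp.2.1, hp.1, (add_comm _ _).trans hp.2.2⟩
  · intro p _
    exact p.swap_swap

theorem InClass.mono {q q' i : ℤ} {f : LaurentSeries (ZMod 2)} (hf : InClass q i f) (h : q' ∣ q) :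
    InClass q' i f :=
  fun n hn => (hf n hn).of_dvd h

theorem InClass.congr {q i j : ℤ} {f : LaurentSeries (ZMod 2)} (hf : InClass q i f)
    (h : i ≡ j [ZMOD q]) : InClass q j f :=
  fun n hn => (hf n hn).trans h

theorem inClass_sq (f : LaurentSeries (ZMod 2)) : InClass 2 0 (f ^ 2) := by
  simpa using InClass.sq (q := 1) (i := 0) (f := f) fun n _ => Int.modEq_one

theorem inClass_pow_four (f : LaurentSeries (ZMod 2)) : InClass 4 0 (f ^ 4) := by
  simpa [← pow_mul] using (inClass_sq f).sq

theorem inClass_pow_eight (f : LaurentSeries (ZMod 2)) : InClass 8 0 (f ^ 8) := by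
  simpa [← pow_mul] using (inClass_pow_four f).sq

theorem proj_add (q j : ℤ) (f g : LaurentSeries (ZMod 2)) :
    proj q j (f + g) = proj q j f + proj q j g := by
  ext n
  simp only [proj, HahnSeries.coeff_add]
  split_ifs <;> simp

theorem InClass.proj_eq_self {q j : ℤ} {f : LaurentSeries (ZMod 2)} (hf : InClass q j f) :
    proj q j f = f := by
  ext n
  simp only [proj, ite_eq_left_iff]
  intro h
  by_contra h0
  exact h (hf n (Ne.symm h0))

theorem InClass.proj_eq_zero {q q' i j : ℤ} {f : LaurentSeries (ZMod 2)} (hf : InClass q i f)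
    (hq : q ∣ q') (h : ¬ i ≡ j [ZMOD q]) : proj q' j f = 0 := by
  ext n
  simp only [proj, HahnSeries.coeff_zero, ite_eq_right_iff]
  intro hn
  by_contra h0
  exact h ((hf n h0).symm.trans (hn.of_dvd hq))

/-- The projections of `1/a`, when `a` differs from a fourth power `b⁴` by a series in degrees
`≡ 1 (mod 8)`. -/
theorem proj_inv {a b : LaurentSeries (ZMod 2)} (ha : a ≠ 0) (hu : InClass 8 1 (a + b ^ 4)) :
    proj 4 2 a⁻¹ = b ^ 4 * (a + b ^ 4) ^ 2 * a⁻¹ ^ 4 ∧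
    proj 4 1 a⁻¹ = b ^ 8 * (a + b ^ 4) * a⁻¹ ^ 4 ∧
    proj 8 3 a⁻¹ = b ^ 16 * (a + b ^ 4) ^ 3 * a⁻¹ ^ 8 := by
  have h2 : (2 : LaurentSeries (ZMod 2)) = 0 := CharTwo.two_eq_zero
  set u := a + b ^ 4 with hu'
  have hau : a = b ^ 4 + u := by grind
  have hu4 : InClass 4 1 u := hu.mono ⟨2, rfl⟩
  have e4 : a⁻¹ = (b ^ 3) ^ 4 * u ^ 0 * a⁻¹ ^ 4 + (b ^ 2) ^ 4 * u ^ 1 * a⁻¹ ^ 4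
      + b ^ 4 * u ^ 2 * a⁻¹ ^ 4 + 1 ^ 4 * u ^ 3 * a⁻¹ ^ 4 := by
    have : (b ^ 4 + u) ^ 3 = (b ^ 3) ^ 4 * u ^ 0 + (b ^ 2) ^ 4 * u ^ 1 + b ^ 4 * u ^ 2
      + 1 ^ 4 * u ^ 3 := by grind
    rw [← hau] at this
    rw [← add_mul, ← add_mul, ← add_mul, ← this]
    field_simp
  have e8 : a⁻¹ = (b ^ 7) ^ 4 * u ^ 0 * (a⁻¹ ^ 2) ^ 4 + (b ^ 6) ^ 4 * u ^ 1 * (a⁻¹ ^ 2) ^ 4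
      + (b ^ 5) ^ 4 * u ^ 2 * (a⁻¹ ^ 2) ^ 4 + (b ^ 2) ^ 8 * u ^ 3 * a⁻¹ ^ 8
      + (b ^ 3) ^ 4 * u ^ 4 * (a⁻¹ ^ 2) ^ 4 + (b ^ 2) ^ 4 * u ^ 5 * (a⁻¹ ^ 2) ^ 4
      + b ^ 4 * u ^ 6 * (a⁻¹ ^ 2) ^ 4 + 1 ^ 8 * u ^ 7 * a⁻¹ ^ 8 := by
    have : (b ^ 4 + u) ^ 7 = (b ^ 7) ^ 4 * u ^ 0 + (b ^ 6) ^ 4 * u ^ 1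
      + (b ^ 5) ^ 4 * u ^ 2 + (b ^ 2) ^ 8 * u ^ 3
      + (b ^ 3) ^ 4 * u ^ 4 + (b ^ 2) ^ 4 * u ^ 5
      + b ^ 4 * u ^ 6 + 1 ^ 8 * u ^ 7 := by grind
    rw [← hau] at this
    rw [show (a⁻¹ ^ 2) ^ 4 = a⁻¹ ^ 8 by ring]
    simp only [← add_mul]
    rw [← this]
    field_simp
  have c4 (k : ℕ) (c d : LaurentSeries (ZMod 2)) : InClass 4 k (c ^ 4 * u ^ k * d ^ 4) :=
    (((inClass_pow_four c).mul (hu4.pow k)).mul (inClass_pow_four d)).congr (by simp)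
  have c8 (k : ℕ) (c d : LaurentSeries (ZMod 2)) : InClass 8 k (c ^ 8 * u ^ k * d ^ 8) :=
    (((inClass_pow_eight c).mul (hu.pow k)).mul (inClass_pow_eight d)).congr (by simp)
  refine ⟨?_, ?_, ?_⟩
  · conv_lhs => rw [e4]
    simp only [proj_add]
    rw [(c4 0 _ _).proj_eq_zero dvd_rfl (by decide), (c4 1 _ _).proj_eq_zero dvd_rfl (by decide),
      InClass.proj_eq_self (j := 2) (c4 2 _ _), (c4 3 _ _).proj_eq_zero dvd_rfl (by decide)]
    ring
  · conv_lhs => rw [e4]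
    simp only [proj_add]
    rw [(c4 0 _ _).proj_eq_zero dvd_rfl (by decide), InClass.proj_eq_self (j := 1) (c4 1 _ _),
      (c4 2 _ _).proj_eq_zero dvd_rfl (by decide), (c4 3 _ _).proj_eq_zero dvd_rfl (by decide)]
    ring
  · conv_lhs => rw [e8]
    simp only [proj_add]
    rw [(c4 0 _ _).proj_eq_zero (by decide) (by decide),
      (c4 1 _ _).proj_eq_zero (by decide) (by decide),
      (c4 2 _ _).proj_eq_zero (by decide) (by decide), InClass.proj_eq_self (j := 3) (c8 3 _ _),
      (c4 4 _ _).proj_eq_zero (by decide) (by decide),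
      (c4 5 _ _).proj_eq_zero (by decide) (by decide),
      (c4 6 _ _).proj_eq_zero (by decide) (by decide),
      (c8 7 _ _).proj_eq_zero dvd_rfl (by decide)]
    ring

theorem proj_inv_mem {S : Subring (LaurentSeries (ZMod 2))} {a b : LaurentSeries (ZMod 2)}
    (haS : a ∈ S) (hbS : b ∈ S) (hu : InClass 8 1 (a + b ^ 4))
    (hR : a ^ 5 + b ^ 5 + a ^ 2 * b ^ 2 + a * b = 0) :
    proj 4 2 a⁻¹ ∈ S ∧ proj 4 1 a⁻¹ ∈ S ∧ proj 8 3 a⁻¹ ∈ S := by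
  have h2 : (2 : LaurentSeries (ZMod 2)) = 0 := CharTwo.two_eq_zero
  by_cases ha : a = 0
  · have h0 (q j : ℤ) : proj q j 0 = 0 := by
      ext n
      simp [proj]
    simp [ha, h0, S.zero_mem]
  obtain ⟨p2, p1, p3⟩ := proj_inv ha hu
  let A : S := ⟨a, haS⟩
  let B : S := ⟨b, hbS⟩
  have q1 : b ^ 2 * (a + b ^ 4) = a ^ 2 * (a ^ 3 * b + b ^ 3) := by grind
  have q2 : b ^ 6 * (a ^ 3 * b + b ^ 3) =
      a ^ 2 * (a * b ^ 7 + a ^ 3 * b ^ 4 + b ^ 6 + a ^ 4 + b + a * b ^ 2) := by grind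
  have q3 : b ^ 5 = a * (a ^ 4 + a * b ^ 2 + b) := by grind
  refine ⟨?_, ?_, ?_⟩
  · have : proj 4 2 a⁻¹ = (a ^ 3 * b + b ^ 3) ^ 2 := by
      rw [p2, show b ^ 4 * (a + b ^ 4) ^ 2 = (b ^ 2 * (a + b ^ 4)) ^ 2 by ring, q1]
      field_simp
    rw [this]
    exact ((A ^ 3 * B + B ^ 3) ^ 2).2
  · have : proj 4 1 a⁻¹ = a * b ^ 7 + a ^ 3 * b ^ 4 + b ^ 6 + a ^ 4 + b + a * b ^ 2 := by
      rw [p1, show b ^ 8 * (a + b ^ 4) = b ^ 6 * (b ^ 2 * (a + b ^ 4)) by ring, q1,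
        mul_left_comm, q2]
      field_simp
    rw [this]
    exact (A * B ^ 7 + A ^ 3 * B ^ 4 + B ^ 6 + A ^ 4 + B + A * B ^ 2).2
  · have : proj 8 3 a⁻¹ = (a ^ 4 + a * b ^ 2 + b) ^ 2 * (a ^ 3 * b + b ^ 3) ^ 3 := by
      rw [p3, show b ^ 16 * (a + b ^ 4) ^ 3 = (b ^ 5) ^ 2 * (b ^ 2 * (a + b ^ 4)) ^ 3 by ring,
        q1, q3]
      field_simp
    rw [this]
    exact ((A ^ 4 + A * B ^ 2 + B) ^ 2 * (A ^ 3 * B + B ^ 3) ^ 3).2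

theorem inClass_thetaL_add_pow_four {i j : ℤ}
    (h : j ≡ 2 * i [ZMOD 5] ∨ j ≡ -(2 * i) [ZMOD 5]) :
    InClass 8 1 (thetaL 5 j + thetaL 5 i ^ 4) := by
  have hps : theta 5 j + theta 5 i ^ 4 =
      genSeries {n : ℤ | n ∈ {n : ℤ | n ≡ j [ZMOD 5]} ∧ ¬ Even n} (fun n => n.natAbs ^ 2) := by
    rw [theta_pow_four_eq_even h, theta_eq_genSeries,
      genSeries_split {n : ℤ | n ≡ j [ZMOD 5]} finite_natAbs_sq Even, add_right_comm,
      CharTwo.add_self_eq_zero, zero_add]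
  have hL : thetaL 5 j + thetaL 5 i ^ 4 =
      ((theta 5 j + theta 5 i ^ 4 : PowerSeries (ZMod 2)) : LaurentSeries (ZMod 2)) := by
    simp [thetaL]
  rw [hL, hps]
  intro k hk
  rw [PowerSeries.coeff_coe] at hk
  split_ifs at hk with hneg
  · exact absurd rfl hk
  · simp only [genSeries, PowerSeries.coeff_mk] at hk
    obtain ⟨n, ⟨_, hodd⟩, hn⟩ := Set.nonempty_of_ncard_ne_zero fun h0 => hk (by rw [h0]; rfl)
    have hkn : k = n ^ 2 := by
      rw [← Int.natAbs_sq, ← Nat.cast_pow, hn]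
      omega
    rw [hkn]
    exact (Int.modEq_iff_dvd.2 (Int.eight_dvd_sq_sub_one_of_odd (Int.not_even_iff_odd.1 hodd))).symm

theorem stmt16 (r : ℤ) (hr : r = 1 ∨ r = 2) :
    proj 4 2 (thetaL 5 r)⁻¹ ∈ Sring 5 2 ∧ proj 4 1 (thetaL 5 r)⁻¹ ∈ Sring 5 2 ∧
      proj 8 3 (thetaL 5 r)⁻¹ ∈ Sring 5 2 := by
  have m1 : thetaL 5 1 ∈ Sring 5 2 := Subring.subset_closure ⟨1, by simp⟩
  have m2 : thetaL 5 2 ∈ Sring 5 2 := Subring.subset_closure ⟨2, by simp⟩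
  have hR : thetaL 5 1 ^ 5 + thetaL 5 2 ^ 5 + thetaL 5 1 ^ 2 * thetaL 5 2 ^ 2 +
      thetaL 5 1 * thetaL 5 2 = 0 := by
    simpa [thetaL] using congrArg (HahnSeries.ofPowerSeries ℤ (ZMod 2)) theta_relation
  rcases hr with rfl | rfl
  · exact proj_inv_mem m1 m2 (inClass_thetaL_add_pow_four (by decide)) hR
  · exact proj_inv_mem m2 m1 (inClass_thetaL_add_pow_four (by decide)) (by linear_combination hR)
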